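/- Let ξ ∈ (0,1). For every θ ∈ ℝ the improper Riemann integral Lc_ξ(θ) = lim_{T→∞} ∫₀^T cos(τ³/3 + θτ − ξπ/2) τ^{−ξ} dτ exists, the resulting function Lc_ξ : ℝ → ℝ is three times differentiable, and it solves Langer's equation: Lc_ξ'''(θ) = θ·Lc_ξ'(θ) + (1−ξ)·Lc_ξ(θ) for all θ ∈ ℝ. -/

import Mathlib

open Real Filter

open MeasureTheory Topology

/-- The integrand `s ^ p * exp (i ((ω s)³ / 3 + θ ω s))`, `ω = exp (i α)`, of the Airy-type
integral along the ray of argument `α`. -/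
noncomputable def rayKernel (p θ α s : ℝ) : ℂ :=
  ((s ^ p : ℝ) : ℂ) * Complex.exp (Complex.I *
    ((Complex.exp (α * Complex.I) * s) ^ 3 / 3 + θ * (Complex.exp (α * Complex.I) * s)))

/-- The pullback of the Airy-type integrand under `z = exp u`, an entire function of `u`. -/
noncomputable def expKernel (p θ : ℝ) (u : ℂ) : ℂ :=
  Complex.exp (Complex.I * (Complex.exp u ^ 3 / 3 + θ * Complex.exp u) + (p + 1) * u)

lemma norm_rayKernel (p θ α : ℝ) {s : ℝ} (hs : 0 ≤ s) :
    ‖rayKernel p θ α s‖ =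
      s ^ p * Real.exp (-(s ^ 3 / 3 * Real.sin (3 * α)) - θ * s * Real.sin α) := by
  have h3 : (Complex.exp (α * Complex.I) * s) ^ 3
      = Complex.exp ((3 * α : ℝ) * Complex.I) * ((s ^ 3 : ℝ) : ℂ) := by
    rw [mul_pow, ← Complex.exp_nat_mul]
    push_cast
    ring_nf
  have hre : (Complex.I * ((Complex.exp (α * Complex.I) * s) ^ 3 / 3
      + θ * (Complex.exp (α * Complex.I) * s))).re
      = -(s ^ 3 / 3 * Real.sin (3 * α)) - θ * s * Real.sin α := by
    have hdiv : Complex.exp ((3 * α : ℝ) * Complex.I) * ((s ^ 3 : ℝ) : ℂ) / 3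
        = ((s ^ 3 / 3 : ℝ) : ℂ) * Complex.exp ((3 * α : ℝ) * Complex.I) := by
      push_cast; ring
    have hlin : (θ : ℂ) * (Complex.exp (α * Complex.I) * s)
        = ((θ * s : ℝ) : ℂ) * Complex.exp (α * Complex.I) := by
      push_cast; ring
    rw [h3, hdiv, hlin, Complex.I_mul_re, Complex.add_im, Complex.im_ofReal_mul,
      Complex.im_ofReal_mul, Complex.exp_ofReal_mul_I_im, Complex.exp_ofReal_mul_I_im]
    ring
  rw [rayKernel, norm_mul, Complex.norm_exp, hre, Complex.norm_real, Real.norm_eq_abs,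
    abs_of_nonneg (Real.rpow_nonneg hs p)]

lemma expKernel_add_mul_I (p θ x y : ℝ) :
    expKernel p θ (x + y * Complex.I) =
      Complex.exp ((p + 1) * (y * Complex.I)) *
        (Real.exp x • rayKernel p θ y (Real.exp x)) := by
  have hp : ((Real.exp x ^ p : ℝ) : ℂ) = Complex.exp (p * x) := by
    rw [← Real.exp_mul]; push_cast; ring_nf
  have hz : Complex.exp (x + y * Complex.I) = Complex.exp (y * Complex.I) * Complex.exp x := by
    rw [← Complex.exp_add, add_comm]
  rw [rayKernel, Complex.real_smul, hp, expKernel, hz, Complex.ofReal_exp]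
  generalize Complex.exp (y * Complex.I) * Complex.exp x = z
  rw [← Complex.exp_add, ← Complex.exp_add, ← Complex.exp_add]
  ring_nf

lemma norm_expKernel_log_add_mul_I (p θ y : ℝ) {T : ℝ} (hT : 0 < T) :
    ‖expKernel p θ ((Real.log T : ℝ) + y * Complex.I)‖ =
      T ^ (p + 1) * Real.exp (-(T ^ 3 / 3 * Real.sin (3 * y)) - θ * T * Real.sin y) := by
  have h1 : ‖Complex.exp (((p : ℂ) + 1) * (y * Complex.I))‖ = 1 := by
    rw [show ((p : ℂ) + 1) * (y * Complex.I) = (((p + 1) * y : ℝ) : ℂ) * Complex.I by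
      push_cast; ring]
    exact Complex.norm_exp_ofReal_mul_I _
  rw [expKernel_add_mul_I, norm_mul, h1, Real.exp_log hT, norm_smul,
    norm_rayKernel _ _ _ hT.le, Real.rpow_add_one hT.ne', Real.norm_eq_abs, abs_of_pos hT]
  ring

lemma differentiable_expKernel (p θ : ℝ) : Differentiable ℂ (expKernel p θ) := by
  unfold expKernel
  fun_prop

lemma continuousOn_rayKernel (p θ α : ℝ) : ContinuousOn (rayKernel p θ α) (Set.Ioi 0) := by
  unfold rayKernel
  refine ContinuousOn.mul ?_ (Continuous.continuousOn (by fun_prop))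
  exact Complex.continuous_ofReal.comp_continuousOn
    (continuousOn_id.rpow_const fun x hx => Or.inl (ne_of_gt hx))

lemma intervalIntegrable_rayKernel {p : ℝ} (hp : -1 < p) (θ α a b : ℝ) :
    IntervalIntegrable (rayKernel p θ α) volume a b := by
  unfold rayKernel
  refine IntervalIntegrable.mul_continuousOn ?_ (Continuous.continuousOn (by fun_prop))
  have h := intervalIntegral.intervalIntegrable_rpow' (a := a) (b := b) hp
  exact ⟨h.1.ofReal, h.2.ofReal⟩

lemma integral_expKernel_log (p θ y : ℝ) {a b : ℝ} (ha : 0 < a) (hb : 0 < b) :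
    ∫ x in (Real.log a)..(Real.log b), expKernel p θ (x + y * Complex.I) =
      Complex.exp ((p + 1) * (y * Complex.I)) * ∫ s in a..b, rayKernel p θ y s := by
  simp_rw [expKernel_add_mul_I]
  rw [intervalIntegral.integral_const_mul]
  congr 1
  have h := intervalIntegral.integral_deriv_smul_comp'' (a := Real.log a) (b := Real.log b)
    (f := Real.exp) (f' := Real.exp) (g := rayKernel p θ y) Real.continuous_exp.continuousOn
    (fun x _ => (Real.hasDerivAt_exp x).hasDerivWithinAt) Real.continuous_exp.continuousOn
    ((continuousOn_rayKernel p θ y).mono (by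
      rintro _ ⟨x, -, rfl⟩
      exact Real.exp_pos x))
  rwa [Real.exp_log ha, Real.exp_log hb] at h

/-- Cauchy's theorem on a sector: the defect between two rays, closed by an arc, does not depend
on the radius. -/
lemma sector_integral_eq {p : ℝ} (hp : -1 < p) (θ β : ℝ) {a b : ℝ} (ha : 0 < a) (hb : 0 < b) :
    ((∫ s in (0 : ℝ)..a, rayKernel p θ 0 s)
        - Complex.exp ((p + 1) * (β * Complex.I)) * (∫ s in (0 : ℝ)..a, rayKernel p θ β s))
        + Complex.I * ∫ y in (0 : ℝ)..β, expKernel p θ ((Real.log a : ℝ) + y * Complex.I) =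
      ((∫ s in (0 : ℝ)..b, rayKernel p θ 0 s)
        - Complex.exp ((p + 1) * (β * Complex.I)) * (∫ s in (0 : ℝ)..b, rayKernel p θ β s))
        + Complex.I * ∫ y in (0 : ℝ)..β, expKernel p θ ((Real.log b : ℝ) + y * Complex.I) := by
  have h := Complex.integral_boundary_rect_eq_zero_of_differentiableOn (expKernel p θ)
    (⟨Real.log a, 0⟩ : ℂ) (⟨Real.log b, β⟩ : ℂ) (differentiable_expKernel p θ).differentiableOn
  have h0 := integral_expKernel_log p θ 0 ha hb
  simp only [Complex.ofReal_zero, zero_mul, mul_zero, Complex.exp_zero, one_mul, smul_eq_mul]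
    at h h0
  rw [h0, integral_expKernel_log p θ β ha hb,
    ← intervalIntegral.integral_interval_sub_left (intervalIntegrable_rayKernel hp θ 0 0 b)
      (intervalIntegrable_rayKernel hp θ 0 0 a),
    ← intervalIntegral.integral_interval_sub_left (intervalIntegrable_rayKernel hp θ β 0 b)
      (intervalIntegrable_rayKernel hp θ β 0 a)] at h
  linear_combination -h

lemma sin_three_mul_bounds {y : ℝ} (hy : y ∈ Set.Ioc (0 : ℝ) (π / 6)) :
    0 ≤ y ∧ 3 * y / 2 ≤ Real.sin (3 * y) ∧ |Real.sin y| ≤ y := by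
  obtain ⟨h0, h1⟩ := hy
  refine ⟨h0.le, ?_, ?_⟩
  · have h := Real.mul_le_sin (x := 3 * y) (by linarith) (by linarith)
    have h2 : (1 : ℝ) / 2 ≤ 2 / π := by
      rw [div_le_div_iff₀ (by norm_num) Real.pi_pos]; linarith [Real.pi_le_four]
    nlinarith
  · simpa [abs_of_pos h0] using Real.abs_sin_le_abs (x := y)

lemma tendsto_arc_integral_nhdsGT_zero {p : ℝ} (hp : -1 < p) (θ : ℝ) :
    Tendsto (fun T : ℝ => ∫ y in (0 : ℝ)..(π / 6),
      expKernel p θ ((Real.log T : ℝ) + y * Complex.I)) (𝓝[>] 0) (𝓝 0) := by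
  have hlim : Tendsto (fun T : ℝ => T ^ (p + 1) * Real.exp (|θ| * T) * |π / 6 - 0|)
      (𝓝[>] 0) (𝓝 0) := by
    have hc : ContinuousAt (fun T : ℝ => T ^ (p + 1) * Real.exp (|θ| * T) * |π / 6 - 0|) 0 :=
      ((Real.continuousAt_rpow_const 0 (p + 1) (Or.inr (by linarith))).mul
        (by fun_prop)).mul continuousAt_const
    have := hc.tendsto.mono_left (nhdsWithin_le_nhds (s := Set.Ioi 0))
    simpa [Real.zero_rpow (show p + 1 ≠ 0 by linarith)] using this
  refine squeeze_zero_norm' ?_ hlim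
  filter_upwards [self_mem_nhdsWithin] with T hT
  have hT : 0 < T := hT
  refine intervalIntegral.norm_integral_le_of_norm_le_const fun y hy => ?_
  rw [Set.uIoc_of_le (by positivity)] at hy
  obtain ⟨h0, h3, -⟩ := sin_three_mul_bounds hy
  rw [norm_expKernel_log_add_mul_I _ _ _ hT]
  gcongr
  have h4 : 0 ≤ T ^ 3 / 3 * Real.sin (3 * y) := by
    have : 0 ≤ Real.sin (3 * y) := by linarith
    positivity
  have h5 : -(θ * T * Real.sin y) ≤ |θ| * T := by
    refine (neg_le_abs _).trans ?_
    rw [abs_mul, abs_mul, abs_of_pos hT]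
    exact mul_le_of_le_one_right (by positivity) (Real.abs_sin_le_one y)
  linarith

lemma tendsto_arc_integral_atTop {p : ℝ} (hp : p < 1) (θ : ℝ) :
    Tendsto (fun T : ℝ => ∫ y in (0 : ℝ)..(π / 6),
      expKernel p θ ((Real.log T : ℝ) + y * Complex.I)) atTop (𝓝 0) := by
  have hlim : Tendsto (fun T : ℝ => T ^ (-(1 - p))) atTop (𝓝 0) :=
    tendsto_rpow_neg_atTop (by linarith)
  refine squeeze_zero_norm' ?_ hlim
  filter_upwards [eventually_ge_atTop (4 + |θ|)] with T hTθ
  have hT : 0 < T := by linarith [abs_nonneg θ]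
  have hb : ∀ y ∈ Set.Ioc (0 : ℝ) (π / 6),
      ‖expKernel p θ ((Real.log T : ℝ) + y * Complex.I)‖
        ≤ T ^ (p + 1) * Real.exp (-T ^ 2 * y) := by
    intro y hy
    obtain ⟨h0, h3, h1⟩ := sin_three_mul_bounds hy
    rw [norm_expKernel_log_add_mul_I _ _ _ hT]
    gcongr
    have h4 : T ^ 3 / 3 * (3 * y / 2) ≤ T ^ 3 / 3 * Real.sin (3 * y) := by gcongr
    have h5 : -(θ * T * Real.sin y) ≤ |θ| * T * y := by
      refine (neg_le_abs _).trans ?_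
      rw [abs_mul, abs_mul, abs_of_pos hT]
      gcongr
    have h6 : |θ| + T ≤ T ^ 2 / 2 := by nlinarith [abs_nonneg θ]
    have h7 : (|θ| + T) * (T * y) ≤ T ^ 2 / 2 * (T * y) := by gcongr
    linarith
  have hderiv : ∀ y : ℝ, HasDerivAt (fun y : ℝ => -(T ^ (p - 1)) * Real.exp (-T ^ 2 * y))
      (T ^ (p + 1) * Real.exp (-T ^ 2 * y)) y := by
    intro y
    have h := (((hasDerivAt_id y).const_mul (-T ^ 2)).exp).const_mul (-(T ^ (p - 1)))
    refine h.congr_deriv ?_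
    rw [show p + 1 = (p - 1) + (2 : ℕ) by push_cast; ring, Real.rpow_add_natCast hT.ne']
    simp only [id_eq]
    ring
  have hcont : Continuous fun y : ℝ => T ^ (p + 1) * Real.exp (-T ^ 2 * y) := by fun_prop
  have hle := intervalIntegral.norm_integral_le_of_norm_le (μ := volume)
    (show (0 : ℝ) ≤ π / 6 by positivity) (Eventually.of_forall hb)
    (hcont.intervalIntegrable _ _)
  rw [intervalIntegral.integral_eq_sub_of_hasDerivAt (fun y _ => hderiv y)
    (hcont.intervalIntegrable _ _)] at hle
  refine hle.trans ?_
  have : 0 ≤ T ^ (p - 1) * Real.exp (-T ^ 2 * (π / 6)) := by positivity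
  rw [neg_sub, mul_zero, Real.exp_zero]
  linarith

lemma tendsto_primitive_rayKernel_zero {p : ℝ} (hp : -1 < p) (θ α : ℝ) :
    Tendsto (fun T : ℝ => ∫ s in (0 : ℝ)..T, rayKernel p θ α s) (𝓝[>] 0) (𝓝 0) := by
  have h := (intervalIntegral.continuous_primitive
    (intervalIntegrable_rayKernel hp θ α) 0).tendsto 0
  rw [intervalIntegral.integral_same] at h
  exact h.mono_left nhdsWithin_le_nhds

/-- Rotation of the contour from the positive real axis to the ray of argument `π / 6`. -/
lemma integral_rayKernel_zero_eq {p : ℝ} (hp : -1 < p) (θ : ℝ) {T : ℝ} (hT : 0 < T) :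
    ∫ s in (0 : ℝ)..T, rayKernel p θ 0 s =
      Complex.exp ((p + 1) * ((π / 6 : ℝ) * Complex.I)) *
          (∫ s in (0 : ℝ)..T, rayKernel p θ (π / 6) s)
        - Complex.I * ∫ y in (0 : ℝ)..(π / 6),
            expKernel p θ ((Real.log T : ℝ) + y * Complex.I) := by
  have hlim := ((tendsto_primitive_rayKernel_zero hp θ 0).sub
    ((tendsto_primitive_rayKernel_zero hp θ (π / 6)).const_mul
      (Complex.exp ((p + 1) * ((π / 6 : ℝ) * Complex.I))))).add
    ((tendsto_arc_integral_nhdsGT_zero hp θ).const_mul Complex.I)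
  simp only [mul_zero, sub_zero, add_zero] at hlim
  have hconst := hlim.congr' (by
    filter_upwards [self_mem_nhdsWithin] with ε hε
    exact sector_integral_eq hp θ (π / 6) hε hT)
  linear_combination tendsto_nhds_unique tendsto_const_nhds hconst

lemma integrableOn_rpow_mul_exp_cubic {p : ℝ} (hp : -1 < p) {M : ℝ} (hM : 0 ≤ M) :
    IntegrableOn (fun s : ℝ => s ^ p * Real.exp (-(s ^ 3 / 3) + M * s)) (Set.Ioi 0) := by
  have h := (integrableOn_rpow_mul_exp_neg_mul_rpow (p := 3) (b := 1 / 6) hp (by norm_num)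
    (by norm_num)).const_mul (Real.exp (M * (1 + 6 * M)))
  refine h.mono' ?_ ?_
  · refine ContinuousOn.aestronglyMeasurable ?_ measurableSet_Ioi
    exact (continuousOn_id.rpow_const fun x hx => Or.inl (ne_of_gt hx)).mul
      (Continuous.continuousOn (by fun_prop))
  · filter_upwards [ae_restrict_mem measurableSet_Ioi] with s hs
    have hs : 0 < s := hs
    rw [Real.norm_of_nonneg (by positivity), mul_left_comm, ← Real.exp_add,
      show s ^ (3 : ℝ) = s ^ 3 by exact_mod_cast Real.rpow_natCast s 3]
    refine mul_le_mul_of_nonneg_left (Real.exp_le_exp.2 ?_) (by positivity)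
    rcases le_total (6 * M) (s ^ 2) with h6 | h6
    · nlinarith [mul_nonneg hM hM]
    · have : s ≤ 1 + 6 * M := by nlinarith [sq_nonneg (s - 1)]
      nlinarith [mul_le_mul_of_nonneg_left this hM, pow_pos hs 3]

lemma norm_rayKernel_pi_div_six_le (p : ℝ) {θ M s : ℝ} (hθ : |θ| ≤ M) (hs : 0 < s) :
    ‖rayKernel p θ (π / 6) s‖ ≤ s ^ p * Real.exp (-(s ^ 3 / 3) + M * s) := by
  rw [norm_rayKernel _ _ _ hs.le, show 3 * (π / 6) = π / 2 by ring, Real.sin_pi_div_two,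
    Real.sin_pi_div_six]
  gcongr
  have h := neg_le_of_abs_le hθ
  have hM : 0 ≤ M := (abs_nonneg θ).trans hθ
  nlinarith [mul_nonneg hM hs.le]

lemma aestronglyMeasurable_rayKernel (p θ α : ℝ) :
    AEStronglyMeasurable (rayKernel p θ α) (volume.restrict (Set.Ioi 0)) :=
  (continuousOn_rayKernel p θ α).aestronglyMeasurable measurableSet_Ioi

lemma integrableOn_rayKernel_pi_div_six {p : ℝ} (hp : -1 < p) (θ : ℝ) :
    IntegrableOn (rayKernel p θ (π / 6)) (Set.Ioi 0) := by
  refine (integrableOn_rpow_mul_exp_cubic hp (abs_nonneg θ)).mono'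
    (aestronglyMeasurable_rayKernel _ _ _) ?_
  filter_upwards [ae_restrict_mem measurableSet_Ioi] with s hs
  exact norm_rayKernel_pi_div_six_le p le_rfl hs

lemma hasDerivAt_rayKernel_param (p θ α : ℝ) {s : ℝ} (hs : 0 < s) :
    HasDerivAt (fun θ => rayKernel p θ α s)
      (Complex.I * Complex.exp (α * Complex.I) * rayKernel (p + 1) θ α s) θ := by
  unfold rayKernel
  have h := ((((((hasDerivAt_id θ).ofReal_comp).mul_const
    (Complex.exp (α * Complex.I) * s)).const_add
      ((Complex.exp (α * Complex.I) * s) ^ 3 / 3)).const_mul Complex.I).cexp).const_mul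
        ((s ^ p : ℝ) : ℂ)
  refine h.congr_deriv ?_
  rw [Real.rpow_add_one hs.ne']
  push_cast
  simp only [id_eq]
  ring

/-- The absolutely convergent Airy-type integral along the ray of argument `π / 6`. -/
noncomputable def rayIntegral (p θ : ℝ) : ℂ := ∫ s in Set.Ioi (0 : ℝ), rayKernel p θ (π / 6) s

lemma hasDerivAt_rayIntegral {p : ℝ} (hp : -1 < p) (θ : ℝ) :
    HasDerivAt (rayIntegral p)
      (Complex.I * Complex.exp ((π / 6 : ℝ) * Complex.I) * rayIntegral (p + 1) θ) θ := by
  have h := (hasDerivAt_integral_of_dominated_loc_of_deriv_le (𝕜 := ℝ)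
    (μ := volume.restrict (Set.Ioi (0 : ℝ)))
    (F := fun θ s => rayKernel p θ (π / 6) s)
    (F' := fun θ s => Complex.I * Complex.exp ((π / 6 : ℝ) * Complex.I) *
      rayKernel (p + 1) θ (π / 6) s)
    (bound := fun s => s ^ (p + 1) * Real.exp (-(s ^ 3 / 3) + (|θ| + 1) * s))
    (Metric.ball_mem_nhds θ one_pos)
    (Eventually.of_forall fun θ' => aestronglyMeasurable_rayKernel _ _ _)
    (integrableOn_rayKernel_pi_div_six hp θ)
    ((aestronglyMeasurable_rayKernel _ _ _).const_mul _) ?_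
    (integrableOn_rpow_mul_exp_cubic (by linarith) (by positivity)) ?_).2
  · rwa [integral_const_mul] at h
  · filter_upwards [ae_restrict_mem measurableSet_Ioi] with s hs θ' hθ'
    rw [norm_mul, norm_mul, Complex.norm_I, Complex.norm_exp_ofReal_mul_I, one_mul, one_mul]
    refine norm_rayKernel_pi_div_six_le _ ?_ hs
    rw [Metric.mem_ball, Real.dist_eq] at hθ'
    linarith [abs_sub_abs_le_abs_sub θ' θ]
  · filter_upwards [ae_restrict_mem measurableSet_Ioi] with s hs θ' _
    exact hasDerivAt_rayKernel_param p θ' (π / 6) hs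

lemma exp_pi_div_six_mul_I_pow_three :
    Complex.exp ((π / 6 : ℝ) * Complex.I) ^ 3 = Complex.I := by
  have h : ((3 : ℕ) : ℂ) * ((π / 6 : ℝ) * Complex.I) = π / 2 * Complex.I := by
    push_cast
    ring
  rw [← Complex.exp_nat_mul, h, Complex.exp_pi_div_two_mul_I]

lemma hasDerivAt_rayKernel_pi_div_six (p θ : ℝ) {s : ℝ} (hs : 0 < s) :
    HasDerivAt (rayKernel (p + 1) θ (π / 6))
      ((p + 1) * rayKernel p θ (π / 6) s
        + Complex.I * Complex.exp ((π / 6 : ℝ) * Complex.I) * θ * rayKernel (p + 1) θ (π / 6) s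
        - rayKernel (p + 3) θ (π / 6) s) s := by
  have hrpow := (Real.hasDerivAt_rpow_const (x := s) (p := p + 1) (Or.inl hs.ne')).ofReal_comp
  have hω := exp_pi_div_six_mul_I_pow_three
  unfold rayKernel
  set ω := Complex.exp ((π / 6 : ℝ) * Complex.I)
  have hlin := ((hasDerivAt_id s).ofReal_comp).const_mul ω
  have h := hrpow.mul ((((hlin.pow 3).div_const 3).add (hlin.const_mul (θ : ℂ))).const_mul
    Complex.I).cexp
  refine h.congr_deriv ?_
  have h3 : s ^ (p + 3) = s ^ p * s ^ 3 := by exact_mod_cast Real.rpow_add_natCast hs.ne' p 3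
  rw [h3, Real.rpow_add_one hs.ne', add_sub_cancel_right]
  simp only [id_eq, Pi.add_apply, Pi.pow_apply]
  push_cast
  set e := Complex.exp _
  linear_combination (s ^ 3 * (s ^ p : ℝ) * e * Complex.I) * hω
    + (s ^ 3 * (s ^ p : ℝ) * e) * Complex.I_sq

/-- Integration by parts for the ray integrals. -/
lemma rayIntegral_add_three {p : ℝ} (hp : -1 < p) (θ : ℝ) :
    rayIntegral (p + 3) θ = (p + 1) * rayIntegral p θ
      + Complex.I * Complex.exp ((π / 6 : ℝ) * Complex.I) * θ * rayIntegral (p + 1) θ := by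
  have i0 := (integrableOn_rayKernel_pi_div_six hp θ).const_mul ((p : ℂ) + 1)
  have i1' := integrableOn_rayKernel_pi_div_six (p := p + 1) (by linarith) θ
  have i1 := i1'.const_mul (Complex.I * Complex.exp ((π / 6 : ℝ) * Complex.I) * θ)
  have i3 := integrableOn_rayKernel_pi_div_six (p := p + 3) (by linarith) θ
  have hint := (i0.add i1).sub i3
  have hder : ∀ s ∈ Set.Ioi (0 : ℝ), _ := fun s hs => hasDerivAt_rayKernel_pi_div_six p θ hs
  have hcont : ContinuousWithinAt (rayKernel (p + 1) θ (π / 6)) (Set.Ici 0) 0 := by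
    refine ContinuousAt.continuousWithinAt ?_
    unfold rayKernel
    refine ContinuousAt.mul ?_ (by fun_prop)
    exact Complex.continuous_ofReal.continuousAt.comp
      (Real.continuousAt_rpow_const 0 (p + 1) (Or.inr (by linarith)))
  have h := integral_Ioi_of_hasDerivAt_of_tendsto hcont hder hint
    (tendsto_zero_of_hasDerivAt_of_integrableOn_Ioi hder hint i1')
  have h0 : rayKernel (p + 1) θ (π / 6) 0 = 0 := by
    simp [rayKernel, Real.zero_rpow (show p + 1 ≠ 0 by linarith)]
  have hsplit := integral_sub (i0.add i1) i3
  simp only [Pi.add_apply] at hsplit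
  rw [integral_add i0 i1, integral_const_mul, integral_const_mul] at hsplit
  rw [hsplit, h0, sub_zero] at h
  unfold rayIntegral
  linear_combination -h

lemma tendsto_integral_rayKernel_zero {p : ℝ} (hp : -1 < p) (hp1 : p < 1) (θ : ℝ) :
    Tendsto (fun T : ℝ => ∫ s in (0 : ℝ)..T, rayKernel p θ 0 s) atTop
      (𝓝 (Complex.exp ((p + 1) * ((π / 6 : ℝ) * Complex.I)) * rayIntegral p θ)) := by
  have h := ((intervalIntegral_tendsto_integral_Ioi 0 (integrableOn_rayKernel_pi_div_six hp θ)
    tendsto_id).const_mul (Complex.exp ((p + 1) * ((π / 6 : ℝ) * Complex.I)))).sub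
    ((tendsto_arc_integral_atTop hp1 θ).const_mul Complex.I)
  rw [mul_zero, sub_zero] at h
  refine h.congr' ?_
  filter_upwards [eventually_gt_atTop 0] with T hT
  exact (integral_rayKernel_zero_eq hp θ hT).symm

lemma integral_cos_mul_rpow_eq_re {p : ℝ} (hp : -1 < p) (θ φ T : ℝ) :
    ∫ τ in (0 : ℝ)..T, Real.cos (τ ^ 3 / 3 + θ * τ - φ) * τ ^ p =
      (Complex.exp ((-φ : ℝ) * Complex.I) * ∫ s in (0 : ℝ)..T, rayKernel p θ 0 s).re := by
  rw [← intervalIntegral.integral_const_mul]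
  have h := intervalIntegral.intervalIntegral_re (𝕜 := ℂ) (μ := volume)
    (f := fun s => Complex.exp ((-φ : ℝ) * Complex.I) * rayKernel p θ 0 s)
    ((intervalIntegrable_rayKernel hp θ 0 0 T).const_mul _)
  refine Eq.trans ?_ h
  refine intervalIntegral.integral_congr fun τ _ => ?_
  have : Complex.exp ((-φ : ℝ) * Complex.I) * rayKernel p θ 0 τ
      = ((τ ^ p : ℝ) : ℂ) * Complex.exp ((τ ^ 3 / 3 + θ * τ - φ : ℝ) * Complex.I) := by
    rw [rayKernel, mul_left_comm, ← Complex.exp_add]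
    simp only [Complex.ofReal_zero, zero_mul, Complex.exp_zero, one_mul]
    congr 2
    push_cast
    ring
  simp only [this, RCLike.re_eq_complex_re, Complex.re_ofReal_mul, Complex.exp_ofReal_mul_I_re]
  ring

lemma hasDerivAt_re_mul_rayIntegral {p : ℝ} (hp : -1 < p) (c : ℂ) (θ : ℝ) :
    HasDerivAt (fun θ => (c * rayIntegral p θ).re)
      (c * (Complex.I * Complex.exp ((π / 6 : ℝ) * Complex.I)) * rayIntegral (p + 1) θ).re θ := by
  have h := Complex.reCLM.hasFDerivAt.comp_hasDerivAt θ ((hasDerivAt_rayIntegral hp θ).const_mul c)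
  rw [mul_assoc]
  exact h

/-- For `ξ ∈ (0,1)`, the improper Riemann integral
`Lc_ξ(θ) = lim_{T→∞} ∫₀^T cos(τ³/3 + θτ − ξπ/2) τ^{−ξ} dτ` exists for every `θ`,
the resulting function is three times differentiable, and it solves Langer's
equation `Lc_ξ''' = θ·Lc_ξ' + (1−ξ)·Lc_ξ`. -/
theorem Lc_exists_and_solves_langer (ξ : ℝ) (hξ : ξ ∈ Set.Ioo (0 : ℝ) 1) :
    ∃ Lc : ℝ → ℝ,
      (∀ θ : ℝ, Tendsto
        (fun T : ℝ => ∫ τ in (0 : ℝ)..T,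
          Real.cos (τ ^ 3 / 3 + θ * τ - ξ * π / 2) * τ ^ (-ξ))
        atTop (nhds (Lc θ))) ∧
      Differentiable ℝ Lc ∧
      Differentiable ℝ (deriv Lc) ∧
      Differentiable ℝ (deriv (deriv Lc)) ∧
      ∀ θ : ℝ, deriv (deriv (deriv Lc)) θ = θ * deriv Lc θ + (1 - ξ) * Lc θ := by
  have hp : -1 < -ξ := by linarith [hξ.2]
  set ζ : ℂ := Complex.I * Complex.exp ((π / 6 : ℝ) * Complex.I) with hζ
  set c : ℂ := Complex.exp ((-(ξ * π / 2) : ℝ) * Complex.I) *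
    Complex.exp (((-ξ : ℝ) + 1) * ((π / 6 : ℝ) * Complex.I)) with hc
  have d0 := fun θ => hasDerivAt_re_mul_rayIntegral hp c θ
  have d1 := fun θ => hasDerivAt_re_mul_rayIntegral (p := -ξ + 1) (by linarith) (c * ζ) θ
  have d2 := fun θ =>
    hasDerivAt_re_mul_rayIntegral (p := -ξ + 1 + 1) (by linarith) (c * ζ * ζ) θ
  have e1 := deriv_eq d0
  have e2 := deriv_eq d1
  have e3 := deriv_eq d2
  refine ⟨fun θ => (c * rayIntegral (-ξ) θ).re, fun θ => ?_, fun θ => (d0 θ).differentiableAt,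
    ?_, ?_, fun θ => ?_⟩
  · have h := (tendsto_integral_rayKernel_zero hp (by linarith [hξ.1]) θ).const_mul
      (Complex.exp ((-(ξ * π / 2) : ℝ) * Complex.I))
    rw [← mul_assoc] at h
    refine ((Complex.continuous_re.tendsto _).comp h).congr fun T => ?_
    exact (integral_cos_mul_rpow_eq_re hp θ (ξ * π / 2) T).symm
  · rw [e1]
    exact fun θ => (d1 θ).differentiableAt
  · rw [e1, e2]
    exact fun θ => (d2 θ).differentiableAt
  · have hζ3 : ζ ^ 3 = 1 := by
      rw [hζ, mul_pow, exp_pi_div_six_mul_I_pow_three, ← pow_succ, Complex.I_pow_four]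
    have hparts := rayIntegral_add_three hp θ
    rw [← hζ] at hparts
    rw [e1, e2, e3, show -ξ + 1 + 1 + 1 = -ξ + 3 by ring]
    have key : c * ζ * ζ * ζ * rayIntegral (-ξ + 3) θ
        = (θ : ℂ) * (c * ζ * rayIntegral (-ξ + 1) θ)
          + ((1 - ξ : ℝ) : ℂ) * (c * rayIntegral (-ξ) θ) := by
      push_cast at hparts ⊢
      linear_combination c * rayIntegral (-ξ + 3) θ * hζ3 + c * hparts
    simp only [← hζ]
    rw [key, Complex.add_re, Complex.re_ofReal_mul, Complex.re_ofReal_mul]
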